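/- arXiv:math/0501553 — 2 statements merged into one kernel-verified Lean document; each statement's English description precedes it below -/
import Mathlib

section
/- For every ν ∈ ℝ and every positive definite real symmetric 3×3 matrix x, the integral ∫_{Ω₃} exp(−tr(y⁻¹) − tr(xy)) (det y)^{ν−2} dy is finite. -/
open MeasureTheory Real Matrix

noncomputable def poch (a : ℝ) (k : ℕ) : ℝ := ∏ i ∈ Finset.range k, (a + i)

def sym3 (a b : Fin 3 → ℝ) : Matrix (Fin 3) (Fin 3) ℝ :=
  !![a 0, b 0, b 1;
     b 0, a 1, b 2;
     b 1, b 2, a 2]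

noncomputable def K3 (ν : ℝ) (x : Matrix (Fin 3) (Fin 3) ℝ) : ℝ :=
  (Real.sqrt 2) ^ 3 *
    ∫ p in {p : (Fin 3 → ℝ) × (Fin 3 → ℝ) | (sym3 p.1 p.2).PosDef},
      Real.exp (-(sym3 p.1 p.2)⁻¹.trace - (x * sym3 p.1 p.2).trace) *
        (sym3 p.1 p.2).det ^ (ν - 2)

def sym2 (a : Fin 2 → ℝ) (b : ℝ) : Matrix (Fin 2) (Fin 2) ℝ := !![a 0, b; b, a 1]

noncomputable def K2 (μ : ℝ) (x : Matrix (Fin 2) (Fin 2) ℝ) : ℝ :=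
  Real.sqrt 2 *
    ∫ p in {p : (Fin 2 → ℝ) × ℝ | (sym2 p.1 p.2).PosDef},
      Real.exp (-(sym2 p.1 p.2)⁻¹.trace - (x * sym2 p.1 p.2).trace) *
        (sym2 p.1 p.2).det ^ (μ - 3/2)

noncomputable def J31 (d ν t₁ t₂ t₃ : ℝ) : ℝ :=
  ∑' m : ℕ × ℕ × ℕ,
    ((-1 : ℝ) ^ (m.1 + m.2.2) * poch (1 + 2*ν + d) (m.1 + 2*m.2.1 + 4*m.2.2)
        * t₁ ^ m.1 * t₂ ^ m.2.1 * t₃ ^ m.2.2) /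
      (poch 1 m.1 * poch 1 m.2.1 * poch 1 m.2.2 * poch (1 + ν) m.2.2
        * poch (1 + ν + d/2) (m.2.1 + 2*m.2.2)
        * poch (1 + ν + d) (m.1 + 2*m.2.1 + 3*m.2.2)
        * poch (1 + 2*ν + d) (m.1 + 2*m.2.1 + 3*m.2.2))

noncomputable def J32 (d ν t₁ t₂ t₃ : ℝ) : ℝ :=
  ∑' m : ℕ × ℕ × ℕ,
    ((-1 : ℝ) ^ (m.1 + m.2.2) * poch (1 + ν) (m.1 + 2*m.2.1 + 4*m.2.2)
        * t₁ ^ ((m.1 : ℝ) - ν - d) * t₂ ^ m.2.1 * t₃ ^ m.2.2) /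
      (poch (1 - ν - d) m.1 * poch 1 m.2.1 * poch 1 m.2.2 * poch (1 + ν) m.2.2
        * poch (1 + ν + d/2) (m.2.1 + 2*m.2.2)
        * poch 1 (m.1 + 2*m.2.1 + 3*m.2.2)
        * poch (1 + ν) (m.1 + 2*m.2.1 + 3*m.2.2))

noncomputable def J33 (d ν t₁ t₂ t₃ : ℝ) : ℝ :=
  ∑' m : ℕ × ℕ × ℕ,
    ((-1 : ℝ) ^ (m.1 + m.2.2) * poch 1 (m.1 + 2*m.2.1 + 4*m.2.2)
        * t₁ ^ m.1 * t₂ ^ ((m.2.1 : ℝ) - ν - d/2) * t₃ ^ m.2.2) /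
      (poch 1 m.1 * poch (1 - ν - d/2) m.2.1 * poch 1 m.2.2 * poch (1 + ν) m.2.2
        * poch 1 (m.2.1 + 2*m.2.2)
        * poch (1 - ν) (m.1 + 2*m.2.1 + 3*m.2.2)
        * poch 1 (m.1 + 2*m.2.1 + 3*m.2.2))

noncomputable def J34 (d ν t₁ t₂ t₃ : ℝ) : ℝ :=
  ∑' m : ℕ × ℕ × ℕ,
    ((-1 : ℝ) ^ (m.1 + m.2.2) * poch (1 + ν) (m.1 + 2*m.2.1 + 4*m.2.2)
        * t₁ ^ ((m.1 : ℝ) + ν) * t₂ ^ ((m.2.1 : ℝ) - ν - d/2) * t₃ ^ m.2.2) /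
      (poch (1 + ν) m.1 * poch (1 - ν - d/2) m.2.1 * poch 1 m.2.2 * poch (1 + ν) m.2.2
        * poch 1 (m.2.1 + 2*m.2.2)
        * poch 1 (m.1 + 2*m.2.1 + 3*m.2.2)
        * poch (1 + ν) (m.1 + 2*m.2.1 + 3*m.2.2))

noncomputable def J21 (d μ t₁ t₂ : ℝ) : ℝ :=
  ∑' m : ℕ × ℕ,
    ((-1 : ℝ) ^ m.1 * t₁ ^ m.1 * t₂ ^ m.2) /
      (poch 1 m.1 * poch 1 m.2 * poch (1 + μ) m.2 * poch (1 + μ + d/2) (m.1 + 2*m.2))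

noncomputable def J22 (d μ t₁ t₂ : ℝ) : ℝ :=
  ∑' m : ℕ × ℕ,
    ((-1 : ℝ) ^ m.1 * t₁ ^ ((m.1 : ℝ) - μ - d/2) * t₂ ^ m.2) /
      (poch (1 - μ - d/2) m.1 * poch 1 m.2 * poch (1 + μ) m.2 * poch 1 (m.1 + 2*m.2))

def herm3 (a : Fin 3 → ℝ) (b : Fin 3 → ℂ) : Matrix (Fin 3) (Fin 3) ℂ :=
  !![(a 0 : ℂ), b 0, b 1;
     (starRingEnd ℂ) (b 0), (a 1 : ℂ), b 2;
     (starRingEnd ℂ) (b 1), (starRingEnd ℂ) (b 2), (a 2 : ℂ)]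

open scoped MatrixOrder in
/-- A positive definite real matrix dominates a positive multiple of the identity. -/
theorem Matrix.PosDef.exists_pos_smul_one_le {n : Type*} [Fintype n] [DecidableEq n] [Nonempty n]
    {x : Matrix n n ℝ} (hx : x.PosDef) :
    ∃ c : ℝ, 0 < c ∧ (x - c • (1 : Matrix n n ℝ)).PosSemidef := by
  obtain ⟨c, hc, h⟩ := (CFC.exists_pos_algebraMap_le_iff (a := x) hx.isHermitian).2
    fun t ht ↦ hx.isStrictlyPositive.spectrum_pos ht
  exact ⟨c, hc, by rwa [Algebra.algebraMap_eq_smul_one, Matrix.le_iff] at h⟩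

theorem Matrix.PosSemidef.trace_mul_nonneg {n : Type*} [Fintype n] {x y : Matrix n n ℝ}
    (hx : x.PosSemidef) (hy : y.PosSemidef) : 0 ≤ (x * y).trace := by
  obtain ⟨m, v, rfl⟩ := Matrix.posSemidef_iff_eq_sum_vecMulVec.mp hy
  rw [Matrix.mul_sum, Matrix.trace_sum]
  refine Finset.sum_nonneg fun i _ ↦ ?_
  rw [Matrix.mul_vecMulVec, Matrix.trace_vecMulVec, dotProduct_comm]
  exact hx.dotProduct_mulVec_nonneg (v i)

theorem Matrix.PosSemidef.det_le_trace_pow {n : Type*} [Fintype n] [DecidableEq n]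
    {y : Matrix n n ℝ} (hy : y.PosSemidef) : y.det ≤ y.trace ^ Fintype.card n := by
  rw [hy.isHermitian.det_eq_prod_eigenvalues, hy.isHermitian.trace_eq_sum_eigenvalues]
  simp only [RCLike.ofReal_real_eq_id, id_eq]
  refine (Finset.prod_le_prod (fun i _ ↦ hy.eigenvalues_nonneg i) fun i hi ↦
    Finset.single_le_sum (fun j _ ↦ hy.eigenvalues_nonneg j) hi).trans_eq ?_
  rw [Finset.prod_const, Finset.card_univ]

theorem Real.rpow_le_pow_add_inv_pow {z s : ℝ} (hz : 0 < z) {n : ℕ} (hn : |s| ≤ n) :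
    z ^ s ≤ z ^ n + z⁻¹ ^ n := by
  obtain ⟨h1, h2⟩ := abs_le.mp hn
  rcases le_total 1 z with h | h
  · have := Real.rpow_le_rpow_of_exponent_le h h2
    rw [Real.rpow_natCast] at this
    have : 0 ≤ z⁻¹ ^ n := by positivity
    linarith
  · have := Real.rpow_le_rpow_of_exponent_ge hz h h1
    rw [Real.rpow_neg hz.le, Real.rpow_natCast, ← inv_pow] at this
    have : 0 ≤ z ^ n := by positivity
    linarith

theorem Real.pow_le_factorial_mul_exp {k t : ℝ} (hk : 0 < k) (ht : 0 ≤ t) (n : ℕ) :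
    t ^ n ≤ n.factorial / k ^ n * Real.exp (k * t) := by
  have h := Real.pow_div_factorial_le_exp _ (mul_nonneg hk.le ht) n
  rw [div_le_iff₀ (by positivity), mul_pow] at h
  rw [div_mul_eq_mul_div, le_div_iff₀ (by positivity)]
  linarith

theorem Real.integrable_exp_neg_mul_abs {k : ℝ} (hk : 0 < k) :
    Integrable fun t : ℝ ↦ Real.exp (-k * |t|) := by
  rw [← integrableOn_univ, ← Set.Iic_union_Ioi (a := (0 : ℝ)), integrableOn_union]
  constructor
  · refine (integrableOn_exp_mul_Iic hk 0).congr_fun (fun t ht ↦ ?_) measurableSet_Iic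
    simp [abs_of_nonpos (Set.mem_Iic.mp ht)]
  · refine (integrableOn_exp_mul_Ioi (neg_lt_zero.mpr hk) 0).congr_fun (fun t ht ↦ ?_)
      measurableSet_Ioi
    simp [abs_of_pos (Set.mem_Ioi.mp ht)]

theorem Real.integrable_exp_neg_mul_sum_abs {ι κ : Type*} [Fintype ι] [Fintype κ]
    {k : ℝ} (hk : 0 < k) :
    Integrable fun p : (ι → ℝ) × (κ → ℝ) ↦
      Real.exp (-k * (∑ i, |p.1 i| + ∑ i, |p.2 i|)) := by
  have h := Real.integrable_exp_neg_mul_abs hk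
  refine ((Integrable.fintype_prod fun _ : ι ↦ h).mul_prod
    (Integrable.fintype_prod fun _ : κ ↦ h)).congr (.of_forall fun p ↦ ?_)
  simp only [← Real.exp_sum, ← Real.exp_add, mul_add, Finset.mul_sum]

theorem exists_exp_neg_trace_inv_mul_det_rpow_le {n : Type*} [Fintype n] [DecidableEq n]
    {k : ℝ} (hk : 0 < k) (s : ℝ) :
    ∃ C : ℝ, 0 ≤ C ∧ ∀ y : Matrix n n ℝ, y.PosDef →
      Real.exp (-y⁻¹.trace) * y.det ^ s ≤ C * Real.exp (k * y.trace) := by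
  obtain ⟨m, hm⟩ := exists_nat_ge |s|
  set N := Fintype.card n * m
  refine ⟨N.factorial / k ^ N + N.factorial / 1 ^ N, by positivity, fun y hy ↦ ?_⟩
  have ht := hy.posSemidef.trace_nonneg
  have ht' := hy.inv.posSemidef.trace_nonneg
  have hd : y.det ^ m ≤ N.factorial / k ^ N * Real.exp (k * y.trace) :=
    (pow_le_pow_left₀ hy.det_pos.le hy.posSemidef.det_le_trace_pow m).trans <| by
      rw [← pow_mul]; exact Real.pow_le_factorial_mul_exp hk ht N
  have hd' : y.det⁻¹ ^ m ≤ N.factorial / 1 ^ N * Real.exp (1 * y⁻¹.trace) := by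
    rw [← Ring.inverse_eq_inv', ← Matrix.det_nonsing_inv]
    exact (pow_le_pow_left₀ hy.inv.det_pos.le hy.inv.posSemidef.det_le_trace_pow m).trans <| by
      rw [← pow_mul]; exact Real.pow_le_factorial_mul_exp one_pos ht' N
  calc Real.exp (-y⁻¹.trace) * y.det ^ s
      ≤ Real.exp (-y⁻¹.trace) * (N.factorial / k ^ N * Real.exp (k * y.trace) +
          N.factorial / 1 ^ N * Real.exp (1 * y⁻¹.trace)) := by
        gcongr
        exact (Real.rpow_le_pow_add_inv_pow hy.det_pos hm).trans (add_le_add hd hd')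
    _ = Real.exp (-y⁻¹.trace) * (N.factorial / k ^ N * Real.exp (k * y.trace)) +
          N.factorial / 1 ^ N * 1 := by
        rw [mul_add, mul_left_comm _ _ (Real.exp (1 * _)), ← Real.exp_add]
        simp
    _ ≤ 1 * (N.factorial / k ^ N * Real.exp (k * y.trace)) +
          N.factorial / 1 ^ N * Real.exp (k * y.trace) := by
        gcongr
        · exact Real.exp_le_one_iff.mpr (by linarith)
        · exact Real.one_le_exp (by positivity)
    _ = _ := by ring

theorem Matrix.PosSemidef.two_mul_abs_apply_le {n : Type*} [Fintype n] [DecidableEq n]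
    {y : Matrix n n ℝ} (hy : y.PosSemidef) (i j : n) : 2 * |y i j| ≤ y i i + y j j := by
  have hs : y j i = y i j := by simpa using hy.isHermitian.apply i j
  have h₁ := hy.dotProduct_mulVec_nonneg (Pi.single i 1 + Pi.single j 1)
  have h₂ := hy.dotProduct_mulVec_nonneg (Pi.single i 1 - Pi.single j 1)
  simp [Matrix.mulVec_add, Matrix.mulVec_sub, add_dotProduct, sub_dotProduct, hs] at h₁ h₂
  rcases abs_cases (y i j) with h | h <;> linarith

theorem sum_abs_le_two_mul_trace_sym3 {a b : Fin 3 → ℝ} (h : (sym3 a b).PosSemidef) :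
    ∑ i, |a i| + ∑ i, |b i| ≤ 2 * (sym3 a b).trace := by
  have h₀ := h.diag_nonneg (i := 0)
  have h₁ := h.diag_nonneg (i := 1)
  have h₂ := h.diag_nonneg (i := 2)
  have h₀₁ := h.two_mul_abs_apply_le 0 1
  have h₀₂ := h.two_mul_abs_apply_le 0 2
  have h₁₂ := h.two_mul_abs_apply_le 1 2
  simp only [sym3, Matrix.of_apply, Matrix.cons_val] at h₀ h₁ h₂ h₀₁ h₀₂ h₁₂
  simp only [Fin.sum_univ_three, sym3, Matrix.trace_fin_three, Matrix.of_apply, Matrix.cons_val,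
    abs_of_nonneg h₀, abs_of_nonneg h₁, abs_of_nonneg h₂]
  linarith

theorem continuous_sym3 : Continuous fun p : (Fin 3 → ℝ) × (Fin 3 → ℝ) ↦ sym3 p.1 p.2 := by
  refine continuous_matrix fun i j ↦ ?_
  fin_cases i <;> fin_cases j <;> simp [sym3] <;> fun_prop

theorem Matrix.isClosed_setOf_posSemidef {n : Type*} [Fintype n] :
    IsClosed {y : Matrix n n ℝ | y.PosSemidef} := by
  simp only [Matrix.posSemidef_iff_dotProduct_mulVec, Set.ofPred_and, Set.ofPred_forall]
  refine .inter ?_ (isClosed_iInter fun v ↦ ?_)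
  · exact isClosed_eq (by fun_prop) continuous_id
  · exact isClosed_le continuous_const (by fun_prop)

theorem measurableSet_posDef_sym3 :
    MeasurableSet {p : (Fin 3 → ℝ) × (Fin 3 → ℝ) | (sym3 p.1 p.2).PosDef} := by
  have h : {p : (Fin 3 → ℝ) × (Fin 3 → ℝ) | (sym3 p.1 p.2).PosDef} =
      {p | (sym3 p.1 p.2).PosSemidef} ∩ {p | (sym3 p.1 p.2).det ≠ 0} := by
    ext p
    exact ⟨fun h ↦ ⟨h.posSemidef, h.det_pos.ne'⟩, fun h ↦ h.1.posDef_iff_det_ne_zero.mpr h.2⟩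
  rw [h]
  exact (Matrix.isClosed_setOf_posSemidef.preimage continuous_sym3).measurableSet.inter
    (isOpen_ne_fun continuous_sym3.matrix_det continuous_const).measurableSet

theorem measurable_exp_trace_mul_det_rpow_sym3 (s : ℝ) (x : Matrix (Fin 3) (Fin 3) ℝ) :
    Measurable fun p : (Fin 3 → ℝ) × (Fin 3 → ℝ) ↦
      Real.exp (-(sym3 p.1 p.2)⁻¹.trace - (x * sym3 p.1 p.2).trace) *
        (sym3 p.1 p.2).det ^ s := by
  have hd := continuous_sym3.matrix_det.measurable
  have ht := (continuous_const.matrix_mul continuous_sym3 (A := fun _ ↦ x)).matrix_trace.measurable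
  have hi : Measurable fun p : (Fin 3 → ℝ) × (Fin 3 → ℝ) ↦ (sym3 p.1 p.2)⁻¹.trace := by
    simp only [Matrix.inv_def, Matrix.trace_smul, Ring.inverse_eq_inv', smul_eq_mul]
    exact hd.inv.mul continuous_sym3.matrix_adjugate.matrix_trace.measurable
  exact (Real.measurable_exp.comp (hi.neg.sub ht)).mul (hd.pow_const s)

theorem K3_integrable (ν : ℝ) (x : Matrix (Fin 3) (Fin 3) ℝ) (hx : x.PosDef) :
    IntegrableOn
      (fun p : (Fin 3 → ℝ) × (Fin 3 → ℝ) =>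
        Real.exp (-(sym3 p.1 p.2)⁻¹.trace - (x * sym3 p.1 p.2).trace) *
          (sym3 p.1 p.2).det ^ (ν - 2))
      {p | (sym3 p.1 p.2).PosDef} := by
  obtain ⟨c, hc, hxc⟩ := hx.exists_pos_smul_one_le
  obtain ⟨C, hC, hbound⟩ :=
    exists_exp_neg_trace_inv_mul_det_rpow_le (n := Fin 3) (half_pos hc) (ν - 2)
  refine Integrable.mono'
    ((Real.integrable_exp_neg_mul_sum_abs (k := c / 4) (by positivity)).const_mul C).integrableOn
    (measurable_exp_trace_mul_det_rpow_sym3 (ν - 2) x).aestronglyMeasurable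
    (ae_restrict_of_forall_mem measurableSet_posDef_sym3 fun p hp ↦ ?_)
  have hp : (sym3 p.1 p.2).PosDef := hp
  have htr := hxc.trace_mul_nonneg hp.posSemidef
  simp only [sub_mul, smul_mul_assoc, one_mul, Matrix.trace_sub, Matrix.trace_smul,
    smul_eq_mul] at htr
  have habs := sum_abs_le_two_mul_trace_sym3 hp.posSemidef
  rw [Real.norm_of_nonneg (mul_nonneg (Real.exp_nonneg _) (Real.rpow_nonneg hp.det_pos.le _)),
    sub_eq_add_neg, Real.exp_add, mul_right_comm]
  calc _ ≤ C * Real.exp (c / 2 * (sym3 p.1 p.2).trace) *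
        Real.exp (-(x * sym3 p.1 p.2).trace) := by
        exact mul_le_mul_of_nonneg_right (hbound _ hp) (Real.exp_nonneg _)
    _ = C * Real.exp (c / 2 * (sym3 p.1 p.2).trace + -(x * sym3 p.1 p.2).trace) := by
        rw [Real.exp_add, mul_assoc]
    _ ≤ _ := by
        gcongr
        nlinarith
end

section
/- Let d > 0 and ν ∈ ℝ be such that none of ν, ν + d/2, ν + d, 2ν + d is a negative integer. Then the function g(t₁,t₂,t₃) = J_ν^{[3,1]}(t₁,t₂,t₃) is smooth on ℝ³ and satisfies, at every point (t₁,t₂,t₃) ∈ ℝ³, the three equations: t₁·∂₁²g + 2t₂·∂₁∂₂g + 2t₃·∂₁∂₃g + t₃·∂₂²g + (ν+1+d)·∂₁g + g = 0; t₂·∂₂²g + 2t₃·∂₂∂₃g − ∂₁²g + (ν+1+d/2)·∂₂g = 0; and t₃·∂₃²g − 2∂₁∂₂g − t₁·∂₂²g + (ν+1)·∂₃g = 0, where ∂ᵢ denotes partial differentiation with respect to tᵢ. -/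
open MeasureTheory Real Matrix

open scoped Nat

/-- The formal power series in three variables with coefficients `c`, summed at `p`. -/
noncomputable def tripleSeries (c : ℕ × ℕ × ℕ → ℝ) (p : ℝ × ℝ × ℝ) : ℝ :=
  ∑' m : ℕ × ℕ × ℕ, c m * (p.1 ^ m.1 * p.2.1 ^ m.2.1 * p.2.2 ^ m.2.2)

/-- The coefficients of `exp (D * (t₁ + t₂ + t₃))`. -/
noncomputable def expCoeff (D : ℝ) (m : ℕ × ℕ × ℕ) : ℝ :=
  D ^ m.1 / m.1 ! * (D ^ m.2.1 / m.2.1 ! * (D ^ m.2.2 / m.2.2 !))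

/-- Coefficients dominated by those of some `K * exp (D * (t₁ + t₂ + t₃))`. -/
def ExpBounded (c : ℕ × ℕ × ℕ → ℝ) : Prop :=
  ∃ K D : ℝ, 0 ≤ K ∧ 0 ≤ D ∧ ∀ m, |c m| ≤ K * expCoeff D m

/-- Coefficients of the partial derivative in the first variable. -/
def diffFst (c : ℕ × ℕ × ℕ → ℝ) (m : ℕ × ℕ × ℕ) : ℝ := (m.1 + 1) * c (m.1 + 1, m.2.1, m.2.2)

/-- Coefficients of the partial derivative in the second variable. -/
def diffSnd (c : ℕ × ℕ × ℕ → ℝ) (m : ℕ × ℕ × ℕ) : ℝ := (m.2.1 + 1) * c (m.1, m.2.1 + 1, m.2.2)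

/-- Coefficients of the partial derivative in the third variable. -/
def diffTrd (c : ℕ × ℕ × ℕ → ℝ) (m : ℕ × ℕ × ℕ) : ℝ := (m.2.2 + 1) * c (m.1, m.2.1, m.2.2 + 1)

/-- Coefficients of the product with the first variable. -/
def mulFst (c : ℕ × ℕ × ℕ → ℝ) : ℕ × ℕ × ℕ → ℝ
  | (0, _, _) => 0
  | (i + 1, j, k) => c (i, j, k)

/-- Coefficients of the product with the second variable. -/
def mulSnd (c : ℕ × ℕ × ℕ → ℝ) : ℕ × ℕ × ℕ → ℝ
  | (_, 0, _) => 0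
  | (i, j + 1, k) => c (i, j, k)

/-- Coefficients of the product with the third variable. -/
def mulTrd (c : ℕ × ℕ × ℕ → ℝ) : ℕ × ℕ × ℕ → ℝ
  | (_, _, 0) => 0
  | (i, j, k + 1) => c (i, j, k)

lemma expCoeff_nonneg {D : ℝ} (hD : 0 ≤ D) (m : ℕ × ℕ × ℕ) : 0 ≤ expCoeff D m := by
  unfold expCoeff; positivity

lemma summable_expCoeff {D : ℝ} (hD : 0 ≤ D) : Summable (expCoeff D) := by
  have h := Real.summable_pow_div_factorial D
  have h0 : 0 ≤ fun n : ℕ => D ^ n / n ! := fun n => by positivity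
  exact h.mul_of_nonneg (h.mul_of_nonneg h h0 h0) h0 fun m => mul_nonneg (h0 _) (h0 _)

lemma expCoeff_mul_pow (D R : ℝ) (m : ℕ × ℕ × ℕ) :
    expCoeff D m * (R ^ m.1 * R ^ m.2.1 * R ^ m.2.2) = expCoeff (D * R) m := by
  simp only [expCoeff, mul_pow]; ring

lemma expCoeff_mono {D E : ℝ} (hD : 0 ≤ D) (h : D ≤ E) (m : ℕ × ℕ × ℕ) :
    expCoeff D m ≤ expCoeff E m := by
  have hE := hD.trans h
  unfold expCoeff; gcongr

lemma natCast_mul_expCoeff_le {D : ℝ} (hD : 0 ≤ D) (m : ℕ × ℕ × ℕ) {n : ℕ}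
    (hn : n ≤ m.1 + m.2.1 + m.2.2) : n * expCoeff D m ≤ expCoeff (D * 2) m := by
  rw [← expCoeff_mul_pow, mul_comm]
  refine mul_le_mul_of_nonneg_left ?_ (expCoeff_nonneg hD m)
  rw [← pow_add, ← pow_add]
  exact_mod_cast hn.trans Nat.lt_two_pow_self.le

lemma hasSum_succ_fst_iff {g : ℕ × ℕ × ℕ → ℝ} {s : ℝ} (hg : ∀ j k, g (0, j, k) = 0) :
    HasSum (fun m : ℕ × ℕ × ℕ => g (m.1 + 1, m.2.1, m.2.2)) s ↔ HasSum g s := by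
  refine Function.Injective.hasSum_iff (g := fun m : ℕ × ℕ × ℕ => (m.1 + 1, m.2.1, m.2.2)) ?_ ?_
  · rintro ⟨i, j, k⟩ ⟨i', j', k'⟩ h
    simpa using h
  · rintro ⟨_ | i, j, k⟩ h
    · exact hg j k
    · exact absurd ⟨(i, j, k), rfl⟩ h

lemma hasSum_succ_snd_iff {g : ℕ × ℕ × ℕ → ℝ} {s : ℝ} (hg : ∀ i k, g (i, 0, k) = 0) :
    HasSum (fun m : ℕ × ℕ × ℕ => g (m.1, m.2.1 + 1, m.2.2)) s ↔ HasSum g s := by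
  refine Function.Injective.hasSum_iff (g := fun m : ℕ × ℕ × ℕ => (m.1, m.2.1 + 1, m.2.2)) ?_ ?_
  · rintro ⟨i, j, k⟩ ⟨i', j', k'⟩ h
    simpa using h
  · rintro ⟨i, _ | j, k⟩ h
    · exact hg i k
    · exact absurd ⟨(i, j, k), rfl⟩ h

lemma hasSum_succ_trd_iff {g : ℕ × ℕ × ℕ → ℝ} {s : ℝ} (hg : ∀ i j, g (i, j, 0) = 0) :
    HasSum (fun m : ℕ × ℕ × ℕ => g (m.1, m.2.1, m.2.2 + 1)) s ↔ HasSum g s := by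
  refine Function.Injective.hasSum_iff (g := fun m : ℕ × ℕ × ℕ => (m.1, m.2.1, m.2.2 + 1)) ?_ ?_
  · rintro ⟨i, j, k⟩ ⟨i', j', k'⟩ h
    simpa using h
  · rintro ⟨i, j, _ | k⟩ h
    · exact hg i j
    · exact absurd ⟨(i, j, k), rfl⟩ h

namespace ExpBounded

variable {c : ℕ × ℕ × ℕ → ℝ}

lemma of_succ_le {b : ℕ × ℕ × ℕ → ℝ} {s : ℕ × ℕ × ℕ → ℕ × ℕ × ℕ} {n : ℕ × ℕ × ℕ → ℕ}
    (hc : ExpBounded c) (hb : ∀ m, b m = (n m + 1) * c (s m))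
    (hs : ∀ D m, (n m + 1) * expCoeff D (s m) = D * expCoeff D m) : ExpBounded b := by
  obtain ⟨K, D, hK, hD, h⟩ := hc
  refine ⟨K * D, D, by positivity, hD, fun m => ?_⟩
  have hn : (0 : ℝ) ≤ n m + 1 := by positivity
  rw [hb, abs_mul, abs_of_nonneg hn, mul_assoc, ← hs, mul_left_comm]
  exact mul_le_mul_of_nonneg_left (h _) hn

lemma diffFst (hc : ExpBounded c) : ExpBounded (diffFst c) :=
  hc.of_succ_le (n := fun m => m.1) (s := fun m => (m.1 + 1, m.2.1, m.2.2)) (fun _ => rfl)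
    fun D m => by
      simp only [expCoeff, Nat.factorial_succ, Nat.cast_mul, Nat.cast_add, Nat.cast_one]
      field_simp
      ring

lemma diffSnd (hc : ExpBounded c) : ExpBounded (diffSnd c) :=
  hc.of_succ_le (n := fun m => m.2.1) (s := fun m => (m.1, m.2.1 + 1, m.2.2)) (fun _ => rfl)
    fun D m => by
      simp only [expCoeff, Nat.factorial_succ, Nat.cast_mul, Nat.cast_add, Nat.cast_one]
      field_simp
      ring

lemma diffTrd (hc : ExpBounded c) : ExpBounded (diffTrd c) :=
  hc.of_succ_le (n := fun m => m.2.2) (s := fun m => (m.1, m.2.1, m.2.2 + 1)) (fun _ => rfl)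
    fun D m => by
      simp only [expCoeff, Nat.factorial_succ, Nat.cast_mul, Nat.cast_add, Nat.cast_one]
      field_simp
      ring

/-- Terms of total degree at most that of `m`, multiplied by an exponent of `m`, are dominated by
a summable family uniformly on balls. -/
lemma exists_summable_bound (hc : ExpBounded c) (R : ℝ) :
    ∃ u : ℕ × ℕ × ℕ → ℝ, Summable u ∧ ∀ m (n i j k : ℕ) (x y z : ℝ),
      n ≤ m.1 + m.2.1 + m.2.2 → i ≤ m.1 → j ≤ m.2.1 → k ≤ m.2.2 → |x| ≤ R → |y| ≤ R → |z| ≤ R →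
      |c m * (x ^ i * y ^ j * z ^ k)| ≤ u m ∧ |c m * (n * (x ^ i * y ^ j * z ^ k))| ≤ u m := by
  obtain ⟨K, D, hK, hD, h⟩ := hc
  set S := max R 1 with hS
  have hS1 : 1 ≤ S := le_max_right _ _
  have hDS : 0 ≤ D * S := by positivity
  refine ⟨fun m => K * expCoeff (D * S * 2) m, (summable_expCoeff (by positivity)).mul_left K, ?_⟩
  intro m n i j k x y z hn hi hj hk hx hy hz
  have key (w : ℝ) (hw : |w| ≤ R) {a b : ℕ} (hab : a ≤ b) : |w| ^ a ≤ S ^ b :=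
    (pow_le_pow_left₀ (abs_nonneg w) (hw.trans (le_max_left _ _)) a).trans
      (pow_le_pow_right₀ hS1 hab)
  have hmon : |x ^ i * y ^ j * z ^ k| ≤ S ^ m.1 * S ^ m.2.1 * S ^ m.2.2 := by
    rw [abs_mul, abs_mul, abs_pow, abs_pow, abs_pow]
    have := key x hx hi
    have := key y hy hj
    have := key z hz hk
    gcongr
  have hmul : |c m| * |x ^ i * y ^ j * z ^ k| ≤ K * expCoeff (D * S) m := by
    rw [← expCoeff_mul_pow, ← mul_assoc]
    exact mul_le_mul (h m) hmon (abs_nonneg _) (mul_nonneg hK (expCoeff_nonneg hD m))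
  constructor
  · rw [abs_mul]
    refine hmul.trans (mul_le_mul_of_nonneg_left (expCoeff_mono hDS ?_ m) hK)
    linarith
  · rw [abs_mul, abs_mul, Nat.abs_cast, mul_left_comm]
    calc (n : ℝ) * (|c m| * |x ^ i * y ^ j * z ^ k|) ≤ n * (K * expCoeff (D * S) m) := by gcongr
      _ = K * (n * expCoeff (D * S) m) := by ring
      _ ≤ _ := mul_le_mul_of_nonneg_left (natCast_mul_expCoeff_le hDS m hn) hK

lemma summable (hc : ExpBounded c) (p : ℝ × ℝ × ℝ) :
    Summable fun m : ℕ × ℕ × ℕ => c m * (p.1 ^ m.1 * p.2.1 ^ m.2.1 * p.2.2 ^ m.2.2) := by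
  obtain ⟨u, hu, h⟩ := hc.exists_summable_bound (max |p.1| (max |p.2.1| |p.2.2|))
  exact Summable.of_norm_bounded hu fun m =>
    (h m 0 m.1 m.2.1 m.2.2 p.1 p.2.1 p.2.2 (Nat.zero_le _) le_rfl le_rfl le_rfl
      (by simp) (by simp) (by simp)).1

lemma hasSum (hc : ExpBounded c) (p : ℝ × ℝ × ℝ) :
    HasSum (fun m : ℕ × ℕ × ℕ => c m * (p.1 ^ m.1 * p.2.1 ^ m.2.1 * p.2.2 ^ m.2.2))
      (tripleSeries c p) :=
  (hc.summable p).hasSum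

lemma hasSum_mulFst (hc : ExpBounded c) (p : ℝ × ℝ × ℝ) :
    HasSum (fun m : ℕ × ℕ × ℕ => mulFst c m * (p.1 ^ m.1 * p.2.1 ^ m.2.1 * p.2.2 ^ m.2.2))
      (p.1 * tripleSeries c p) := by
  refine (hasSum_succ_fst_iff fun _ _ => by simp [mulFst]).1
    (((hc.hasSum p).mul_left p.1).congr_fun ?_)
  intro m
  simp only [mulFst]; ring

lemma hasSum_mulSnd (hc : ExpBounded c) (p : ℝ × ℝ × ℝ) :
    HasSum (fun m : ℕ × ℕ × ℕ => mulSnd c m * (p.1 ^ m.1 * p.2.1 ^ m.2.1 * p.2.2 ^ m.2.2))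
      (p.2.1 * tripleSeries c p) := by
  refine (hasSum_succ_snd_iff fun _ _ => by simp [mulSnd]).1
    (((hc.hasSum p).mul_left p.2.1).congr_fun ?_)
  intro m
  simp only [mulSnd]; ring

lemma hasSum_mulTrd (hc : ExpBounded c) (p : ℝ × ℝ × ℝ) :
    HasSum (fun m : ℕ × ℕ × ℕ => mulTrd c m * (p.1 ^ m.1 * p.2.1 ^ m.2.1 * p.2.2 ^ m.2.2))
      (p.2.2 * tripleSeries c p) := by
  refine (hasSum_succ_trd_iff fun _ _ => by simp [mulTrd]).1
    (((hc.hasSum p).mul_left p.2.2).congr_fun ?_)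
  intro m
  simp only [mulTrd]; ring

lemma hasFDerivAt (hc : ExpBounded c) (p : ℝ × ℝ × ℝ) :
    HasFDerivAt (tripleSeries c)
      (tripleSeries (_root_.diffFst c) p • ContinuousLinearMap.fst ℝ ℝ (ℝ × ℝ)
        + tripleSeries (_root_.diffSnd c) p •
          (ContinuousLinearMap.fst ℝ ℝ ℝ).comp (ContinuousLinearMap.snd ℝ ℝ (ℝ × ℝ))
        + tripleSeries (_root_.diffTrd c) p •
          (ContinuousLinearMap.snd ℝ ℝ ℝ).comp (ContinuousLinearMap.snd ℝ ℝ (ℝ × ℝ))) p := by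
  set X := ContinuousLinearMap.fst ℝ ℝ (ℝ × ℝ)
  set Y := (ContinuousLinearMap.fst ℝ ℝ ℝ).comp (ContinuousLinearMap.snd ℝ ℝ (ℝ × ℝ))
  set Z := (ContinuousLinearMap.snd ℝ ℝ ℝ).comp (ContinuousLinearMap.snd ℝ ℝ (ℝ × ℝ))
  obtain ⟨u, hu, hb⟩ := hc.exists_summable_bound (‖p‖ + 1)
  let g₁ (m : ℕ × ℕ × ℕ) (q : ℝ × ℝ × ℝ) : ℝ :=
    c m * (m.1 * (q.1 ^ (m.1 - 1) * q.2.1 ^ m.2.1 * q.2.2 ^ m.2.2))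
  let g₂ (m : ℕ × ℕ × ℕ) (q : ℝ × ℝ × ℝ) : ℝ :=
    c m * (m.2.1 * (q.1 ^ m.1 * q.2.1 ^ (m.2.1 - 1) * q.2.2 ^ m.2.2))
  let g₃ (m : ℕ × ℕ × ℕ) (q : ℝ × ℝ × ℝ) : ℝ :=
    c m * (m.2.2 * (q.1 ^ m.1 * q.2.1 ^ m.2.1 * q.2.2 ^ (m.2.2 - 1)))
  have coord {q : ℝ × ℝ × ℝ} (hq : q ∈ Metric.ball (0 : ℝ × ℝ × ℝ) (‖p‖ + 1)) :
      |q.1| ≤ ‖p‖ + 1 ∧ |q.2.1| ≤ ‖p‖ + 1 ∧ |q.2.2| ≤ ‖p‖ + 1 := by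
    have hq' : ‖q‖ ≤ ‖p‖ + 1 := (mem_ball_zero_iff.1 hq).le
    exact ⟨(norm_fst_le q).trans hq', ((norm_fst_le q.2).trans (norm_snd_le q)).trans hq',
      ((norm_snd_le q.2).trans (norm_snd_le q)).trans hq'⟩
  have hp : p ∈ Metric.ball (0 : ℝ × ℝ × ℝ) (‖p‖ + 1) := by simp
  have hg {q : ℝ × ℝ × ℝ} (hq : q ∈ Metric.ball (0 : ℝ × ℝ × ℝ) (‖p‖ + 1)) (m : ℕ × ℕ × ℕ) :
      |g₁ m q| ≤ u m ∧ |g₂ m q| ≤ u m ∧ |g₃ m q| ≤ u m := by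
    obtain ⟨h₁, h₂, h₃⟩ := coord hq
    exact ⟨(hb m m.1 (m.1 - 1) m.2.1 m.2.2 _ _ _ (by lia) (by lia) le_rfl le_rfl h₁ h₂ h₃).2,
      (hb m m.2.1 m.1 (m.2.1 - 1) m.2.2 _ _ _ (by lia) le_rfl (by lia) le_rfl h₁ h₂ h₃).2,
      (hb m m.2.2 m.1 m.2.1 (m.2.2 - 1) _ _ _ (by lia) le_rfl le_rfl (by lia) h₁ h₂ h₃).2⟩
  have s₁ : HasSum (fun m => g₁ m p) (tripleSeries (_root_.diffFst c) p) := by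
    refine (hasSum_succ_fst_iff fun _ _ => by simp [g₁]).1 ((hc.diffFst.hasSum p).congr_fun ?_)
    intro m
    simp [g₁, _root_.diffFst]; ring
  have s₂ : HasSum (fun m => g₂ m p) (tripleSeries (_root_.diffSnd c) p) := by
    refine (hasSum_succ_snd_iff fun _ _ => by simp [g₂]).1 ((hc.diffSnd.hasSum p).congr_fun ?_)
    intro m
    simp [g₂, _root_.diffSnd]; ring
  have s₃ : HasSum (fun m => g₃ m p) (tripleSeries (_root_.diffTrd c) p) := by
    refine (hasSum_succ_trd_iff fun _ _ => by simp [g₃]).1 ((hc.diffTrd.hasSum p).congr_fun ?_)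
    intro m
    simp [g₃, _root_.diffTrd]; ring
  rw [← (((s₁.smul_const X).add (s₂.smul_const Y)).add (s₃.smul_const Z)).tsum_eq]
  refine hasFDerivAt_tsum_of_isPreconnected
    (f' := fun m q => g₁ m q • X + g₂ m q • Y + g₃ m q • Z)
    (u := fun m => u m * ‖X‖ + u m * ‖Y‖ + u m * ‖Z‖)
    (((hu.mul_right _).add (hu.mul_right _)).add (hu.mul_right _))
    Metric.isOpen_ball (convex_ball (0 : ℝ × ℝ × ℝ) (‖p‖ + 1)).isPreconnected
    (fun m q _ => ?_) (fun m q hq => ?_) hp (hc.summable p) hp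
  · have e₁ : HasFDerivAt (fun q : ℝ × ℝ × ℝ => q.1) X q := X.hasFDerivAt
    have e₂ : HasFDerivAt (fun q : ℝ × ℝ × ℝ => q.2.1) Y q := Y.hasFDerivAt
    have e₃ : HasFDerivAt (fun q : ℝ × ℝ × ℝ => q.2.2) Z q := Z.hasFDerivAt
    refine ((((e₁.pow m.1).mul (e₂.pow m.2.1)).mul (e₃.pow m.2.2)).const_mul (c m)).congr_fderiv ?_
    simp only [g₁, g₂, g₃, Pi.mul_apply, nsmul_eq_mul]
    module
  · obtain ⟨h₁, h₂, h₃⟩ := hg hq m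
    refine (norm_add₃_le).trans ?_
    rw [norm_smul, norm_smul, norm_smul]
    gcongr <;> assumption

lemma contDiff (hc : ExpBounded c) : ContDiff ℝ (⊤ : ℕ∞) (tripleSeries c) := by
  rw [contDiff_infty]
  intro n
  induction n generalizing c with
  | zero =>
    exact contDiff_zero.2 (continuous_iff_continuousAt.2 fun p => (hc.hasFDerivAt p).continuousAt)
  | succ n ih =>
    rw [Nat.cast_add, Nat.cast_one, contDiff_succ_iff_hasFDerivAt]
    exact ⟨_, (((ih hc.diffFst).smul contDiff_const).add
      ((ih hc.diffSnd).smul contDiff_const)).add ((ih hc.diffTrd).smul contDiff_const),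
      hc.hasFDerivAt⟩

lemma deriv_fst (hc : ExpBounded c) (t₁ t₂ t₃ : ℝ) :
    deriv (fun s => tripleSeries c (s, t₂, t₃)) t₁ =
      tripleSeries (_root_.diffFst c) (t₁, t₂, t₃) := by
  have h : HasDerivAt (fun s : ℝ => (s, t₂, t₃)) (1, 0, 0) t₁ :=
    (hasDerivAt_id t₁).prodMk (hasDerivAt_const t₁ (t₂, t₃))
  have := ((hc.hasFDerivAt (t₁, t₂, t₃)).comp_hasDerivAt t₁ h).deriv
  simpa [Function.comp_def] using this

lemma deriv_snd (hc : ExpBounded c) (t₁ t₂ t₃ : ℝ) :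
    deriv (fun s => tripleSeries c (t₁, s, t₃)) t₂ =
      tripleSeries (_root_.diffSnd c) (t₁, t₂, t₃) := by
  have h : HasDerivAt (fun s : ℝ => (t₁, s, t₃)) (0, 1, 0) t₂ :=
    (hasDerivAt_const t₂ t₁).prodMk ((hasDerivAt_id t₂).prodMk (hasDerivAt_const t₂ t₃))
  have := ((hc.hasFDerivAt (t₁, t₂, t₃)).comp_hasDerivAt t₂ h).deriv
  simpa [Function.comp_def] using this

lemma deriv_trd (hc : ExpBounded c) (t₁ t₂ t₃ : ℝ) :
    deriv (fun s => tripleSeries c (t₁, t₂, s)) t₃ =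
      tripleSeries (_root_.diffTrd c) (t₁, t₂, t₃) := by
  have h : HasDerivAt (fun s : ℝ => (t₁, t₂, s)) (0, 0, 1) t₃ :=
    (hasDerivAt_const t₃ t₁).prodMk ((hasDerivAt_const t₃ t₂).prodMk (hasDerivAt_id t₃))
  have := ((hc.hasFDerivAt (t₁, t₂, t₃)).comp_hasDerivAt t₃ h).deriv
  simpa [Function.comp_def] using this

end ExpBounded

lemma poch_succ (a : ℝ) (k : ℕ) : poch a (k + 1) = poch a k * (a + k) :=
  Finset.prod_range_succ _ _

lemma poch_one (k : ℕ) : poch 1 k = k ! := by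
  induction k with
  | zero => simp [poch]
  | succ k ih => rw [poch_succ, ih, Nat.factorial_succ]; push_cast; ring

lemma poch_ne_zero {a : ℝ} (ha : ∀ n : ℕ, a + n ≠ 0) (k : ℕ) : poch a k ≠ 0 :=
  Finset.prod_ne_zero_iff.2 fun i _ => ha i

lemma abs_poch_le (a : ℝ) (k : ℕ) : |poch a k| ≤ (max |a| 1) ^ k * k ! := by
  induction k with
  | zero => simp [poch]
  | succ k ih =>
    have h : |a + k| ≤ max |a| 1 * (k + 1) := by
      have h₁ := abs_add_le a k
      rw [Nat.abs_cast] at h₁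
      nlinarith [le_max_left |a| 1, le_max_right |a| 1, (Nat.cast_nonneg k : (0 : ℝ) ≤ k)]
    rw [poch_succ, abs_mul, Nat.factorial_succ]
    calc |poch a k| * |a + k| ≤ ((max |a| 1) ^ k * k !) * (max |a| 1 * (k + 1)) := by gcongr
      _ = _ := by push_cast; ring

lemma exists_pos_mul_le_abs_add {a : ℝ} (ha : ∀ n : ℕ, a + n ≠ 0) :
    ∃ δ : ℝ, 0 < δ ∧ δ ≤ 1 ∧ ∀ n : ℕ, δ * (n + 1) ≤ |a + n| := by
  obtain ⟨N, hN⟩ := exists_nat_ge (2 * |a| + 1)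
  have hne : (Finset.range (N + 1)).Nonempty := ⟨0, by simp⟩
  obtain ⟨i, -, hi⟩ := Finset.exists_min_image (Finset.range (N + 1)) (fun n => |a + n|) hne
  have hpos : 0 < |a + i| := abs_pos.2 (ha i)
  refine ⟨min (|a + i| / (N + 1)) (1 / 2), by positivity,
    (min_le_right _ _).trans (by norm_num), fun n => ?_⟩
  rcases le_or_gt n N with h | h
  · calc min (|a + i| / (N + 1)) (1 / 2) * (n + 1) ≤ |a + i| / (N + 1) * (N + 1) := by
          gcongr; exact min_le_left _ _
      _ = |a + i| := by field_simp
      _ ≤ |a + n| := hi n (by simpa using Nat.lt_succ_of_le h)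
  · have h' : (N : ℝ) ≤ n := by exact_mod_cast h.le
    calc min (|a + i| / (N + 1)) (1 / 2) * (n + 1) ≤ 1 / 2 * (n + 1) := by
          gcongr; exact min_le_right _ _
      _ ≤ |a + n| := by
          have h₁ := le_abs_self (a + n)
          have h₂ := neg_abs_le a
          linarith

lemma exists_pow_mul_factorial_le_abs_poch {a : ℝ} (ha : ∀ n : ℕ, a + n ≠ 0) :
    ∃ δ : ℝ, 0 < δ ∧ δ ≤ 1 ∧ ∀ k : ℕ, δ ^ k * k ! ≤ |poch a k| := by
  obtain ⟨δ, hδ, hδ1, h⟩ := exists_pos_mul_le_abs_add ha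
  refine ⟨δ, hδ, hδ1, fun k => ?_⟩
  induction k with
  | zero => simp [poch]
  | succ k ih =>
    rw [poch_succ, abs_mul, Nat.factorial_succ]
    calc δ ^ (k + 1) * ((k + 1) * k ! : ℕ) = (δ ^ k * k !) * (δ * (k + 1)) := by push_cast; ring
      _ ≤ _ := by gcongr; exact h k

/-- The coefficients of `J31`. -/
noncomputable def J31Coeff (d ν : ℝ) (m : ℕ × ℕ × ℕ) : ℝ :=
  ((-1 : ℝ) ^ (m.1 + m.2.2) * poch (1 + 2*ν + d) (m.1 + 2*m.2.1 + 4*m.2.2)) /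
    (poch 1 m.1 * poch 1 m.2.1 * poch 1 m.2.2 * poch (1 + ν) m.2.2
      * poch (1 + ν + d/2) (m.2.1 + 2*m.2.2)
      * poch (1 + ν + d) (m.1 + 2*m.2.1 + 3*m.2.2)
      * poch (1 + 2*ν + d) (m.1 + 2*m.2.1 + 3*m.2.2))

lemma J31_eq_tripleSeries (d ν t₁ t₂ t₃ : ℝ) :
    J31 d ν t₁ t₂ t₃ = tripleSeries (J31Coeff d ν) (t₁, t₂, t₃) :=
  tsum_congr fun m => by rw [J31Coeff]; ring

lemma abs_poch_add_le {b δ : ℝ} (hδ : 0 < δ) (hδ1 : δ ≤ 1)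
    (h : ∀ k : ℕ, δ ^ k * k ! ≤ |poch b k|) (n k : ℕ) :
    |poch b (n + k)| ≤ (2 * max |b| 1 / δ) ^ (n + k) * k ! * |poch b n| := by
  have hE : 0 < max |b| 1 := by positivity
  have hfac : ((n + k)! : ℝ) ≤ 2 ^ (n + k) * (n ! * k !) := by
    have := Nat.add_choose_mul_factorial_mul_factorial n k
    rw [← this, mul_assoc]
    push_cast
    gcongr
    exact_mod_cast Nat.choose_le_two_pow _ _
  calc |poch b (n + k)| ≤ (max |b| 1) ^ (n + k) * (n + k)! := abs_poch_le _ _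
    _ ≤ (max |b| 1) ^ (n + k) * (2 ^ (n + k) * (n ! * k !)) := by gcongr
    _ = (2 * max |b| 1 / δ) ^ (n + k) * k ! * (δ ^ (n + k) * n !) := by
        rw [div_pow, mul_pow]; field_simp
    _ ≤ (2 * max |b| 1 / δ) ^ (n + k) * k ! * |poch b n| := by
        gcongr
        refine le_trans ?_ (h n)
        gcongr ?_ * _
        exact pow_le_pow_of_le_one hδ.le hδ1 (by lia)

lemma expBounded_J31Coeff {d ν : ℝ} (h1 : ∀ n : ℕ, 1 + ν + n ≠ 0)
    (h2 : ∀ n : ℕ, 1 + ν + d/2 + n ≠ 0) (h3 : ∀ n : ℕ, 1 + ν + d + n ≠ 0)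
    (h4 : ∀ n : ℕ, 1 + 2*ν + d + n ≠ 0) : ExpBounded (J31Coeff d ν) := by
  obtain ⟨α, hα, hα1, ha⟩ := exists_pow_mul_factorial_le_abs_poch h1
  obtain ⟨β, hβ, hβ1, hb⟩ := exists_pow_mul_factorial_le_abs_poch h2
  obtain ⟨γ, hγ, hγ1, hc⟩ := exists_pow_mul_factorial_le_abs_poch h3
  obtain ⟨δ, hδ, hδ1, hd⟩ := exists_pow_mul_factorial_le_abs_poch h4
  obtain ⟨E, hE⟩ : ∃ E, E = 2 * max |1 + 2*ν + d| 1 / δ := ⟨_, rfl⟩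
  have hE1 : 1 ≤ E := by
    rw [hE, le_div_iff₀ hδ]; linarith [le_max_right |1 + 2*ν + d| 1]
  set L := E / (α * β * γ) with hL
  have hprod : α * β * γ ≤ 1 := mul_le_one₀ (mul_le_one₀ hα1 hβ.le hβ1) hγ.le hγ1
  have hprod0 : 0 < α * β * γ := by positivity
  have hL1 : 1 ≤ L := by rw [hL, le_div_iff₀ hprod0]; linarith
  refine ⟨1, L ^ 4, zero_le_one, by positivity, ?_⟩
  rintro ⟨i, j, k⟩
  have lower {η : ℝ} (hη : 0 < η) (hη1 : η ≤ 1) {b : ℝ} (h : ∀ k : ℕ, η ^ k * k ! ≤ |poch b k|)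
      {n : ℕ} (hn : n ≤ i + 2 * j + 4 * k) : η ^ (i + 2 * j + 4 * k) * n ! ≤ |poch b n| := by
    refine le_trans ?_ (h n)
    gcongr ?_ * _
    exact pow_le_pow_of_le_one hη.le hη1 hn
  have one_le_fac (n : ℕ) : (1 : ℝ) ≤ n ! := by exact_mod_cast Nat.factorial_pos n
  have hup := abs_poch_add_le hδ hδ1 hd (i + 2 * j + 3 * k) k
  rw [← hE, show i + 2 * j + 3 * k + k = i + 2 * j + 4 * k by ring] at hup
  have hA := lower hα hα1 ha (n := k) (by lia)
  have hB := (le_mul_of_one_le_right (by positivity) (one_le_fac _)).trans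
    (lower hβ hβ1 hb (n := j + 2 * k) (by lia))
  have hC := (le_mul_of_one_le_right (by positivity) (one_le_fac _)).trans
    (lower hγ hγ1 hc (n := i + 2 * j + 3 * k) (by lia))
  have hD : 0 < |poch (1 + 2*ν + d) (i + 2 * j + 3 * k)| := abs_pos.2 (poch_ne_zero h4 _)
  simp only [J31Coeff, poch_one, abs_div, abs_mul, abs_pow, abs_neg, abs_one, one_pow, one_mul,
    Nat.abs_cast]
  set P := |poch (1 + 2*ν + d) (i + 2 * j + 3 * k)| with hP
  set s := i + 2 * j + 4 * k with hs
  calc |poch (1 + 2*ν + d) s| / (i ! * j ! * k ! * |poch (1 + ν) k| *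
          |poch (1 + ν + d / 2) (j + 2 * k)| * |poch (1 + ν + d) (i + 2 * j + 3 * k)| * P)
      ≤ (E ^ s * k ! * P) / (i ! * j ! * k ! * (α ^ s * k !) * β ^ s * γ ^ s * P) := by gcongr
    _ = L ^ s * (1 / (i ! * j ! * k !)) := by
        rw [hL, div_pow, mul_pow, mul_pow]; field_simp
    _ ≤ L ^ (4 * (i + j + k)) * (1 / (i ! * j ! * k !)) := by
        gcongr
        lia
    _ = expCoeff (L ^ 4) (i, j, k) := by
        simp only [expCoeff]; rw [pow_mul, pow_add, pow_add]; field_simp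

lemma mulFst_diffFst (c : ℕ × ℕ × ℕ → ℝ) (m : ℕ × ℕ × ℕ) : mulFst (diffFst c) m = m.1 * c m := by
  obtain ⟨_ | i, j, k⟩ := m <;> simp [mulFst, diffFst]

lemma mulSnd_diffSnd (c : ℕ × ℕ × ℕ → ℝ) (m : ℕ × ℕ × ℕ) :
    mulSnd (diffSnd c) m = m.2.1 * c m := by
  obtain ⟨i, _ | j, k⟩ := m <;> simp [mulSnd, diffSnd]

lemma mulTrd_diffTrd (c : ℕ × ℕ × ℕ → ℝ) (m : ℕ × ℕ × ℕ) :
    mulTrd (diffTrd c) m = m.2.2 * c m := by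
  obtain ⟨i, j, _ | k⟩ := m <;> simp [mulTrd, diffTrd]

lemma diffFst_diffSnd (c : ℕ × ℕ × ℕ → ℝ) : diffFst (diffSnd c) = diffSnd (diffFst c) := by
  funext m; simp only [diffFst, diffSnd]; ring

lemma diffFst_diffTrd (c : ℕ × ℕ × ℕ → ℝ) : diffFst (diffTrd c) = diffTrd (diffFst c) := by
  funext m; simp only [diffFst, diffTrd]; ring

lemma diffSnd_diffTrd (c : ℕ × ℕ × ℕ → ℝ) : diffSnd (diffTrd c) = diffTrd (diffSnd c) := by
  funext m; simp only [diffSnd, diffTrd]; ring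

lemma J31Coeff_eq (d ν : ℝ) {i j k l n s : ℕ} (hl : j + 2 * k = l) (hn : i + 2 * j + 3 * k = n)
    (hs : i + 2 * j + 4 * k = s) :
    J31Coeff d ν (i, j, k) = (-1) ^ (i + k) * poch (1 + 2*ν + d) s /
      (i ! * j ! * k ! * poch (1 + ν) k * poch (1 + ν + d/2) l
        * poch (1 + ν + d) n * poch (1 + 2*ν + d) n) := by
  simp only [J31Coeff, poch_one, hl, hn, hs]

lemma J31Coeff_recurrence_fst {d ν : ℝ} (h1 : ∀ n : ℕ, 1 + ν + n ≠ 0)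
    (h2 : ∀ n : ℕ, 1 + ν + d/2 + n ≠ 0) (h3 : ∀ n : ℕ, 1 + ν + d + n ≠ 0)
    (h4 : ∀ n : ℕ, 1 + 2*ν + d + n ≠ 0) (m : ℕ × ℕ × ℕ) :
    mulFst (diffFst (diffFst (J31Coeff d ν))) m + 2 * mulSnd (diffFst (diffSnd (J31Coeff d ν))) m
      + 2 * mulTrd (diffFst (diffTrd (J31Coeff d ν))) m
      + mulTrd (diffSnd (diffSnd (J31Coeff d ν))) m
      + (ν + 1 + d) * diffFst (J31Coeff d ν) m + J31Coeff d ν m = 0 := by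
  rw [diffFst_diffSnd, diffFst_diffTrd, mulFst_diffFst, mulSnd_diffSnd, mulTrd_diffTrd]
  obtain ⟨i, j, _ | k⟩ := m
  · obtain ⟨n, hn⟩ : ∃ n, n = i + 2 * j := ⟨_, rfl⟩
    have hn' : (n : ℝ) = i + 2 * j := by rw [hn]; push_cast; ring
    have hp1 := poch_ne_zero h1 0
    have hp2 := poch_ne_zero h2 j
    have hp3 := poch_ne_zero h3 n
    have hp4 := poch_ne_zero h4 n
    have hX := h3 n
    have hY := h4 n
    have e := J31Coeff_eq d ν (i := i) (j := j) (k := 0) (l := j) (n := n) (s := n)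
      (by lia) (by lia) (by lia)
    have eFst := J31Coeff_eq d ν (i := i + 1) (j := j) (k := 0) (l := j) (n := n + 1) (s := n + 1)
      (by lia) (by lia) (by lia)
    simp only [mulTrd, diffFst]
    rw [e, eFst]
    simp only [Nat.factorial_succ, poch_succ _ n, pow_succ, pow_add]
    push_cast
    generalize poch (1 + ν) 0 = p1, poch (1 + ν + d/2) j = p2, poch (1 + ν + d) n = p3,
      poch (1 + 2*ν + d) n = p4 at *
    generalize eX : 1 + ν + d + (n : ℝ) = X, eY : 1 + 2*ν + d + (n : ℝ) = Y at *
    field_simp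
    rw [← eX, hn']
    ring
  · obtain ⟨n, hn⟩ : ∃ n, n = i + 2 * j + 3 * k + 3 := ⟨_, rfl⟩
    have hn' : (n : ℝ) = i + 2 * j + 3 * k + 3 := by rw [hn]; push_cast; ring
    have hp1 := poch_ne_zero h1 k
    have hp2 := poch_ne_zero h2 (j + 2 * k + 2)
    have hp3 := poch_ne_zero h3 n
    have hp4 := poch_ne_zero h4 n
    have hW := h1 k
    have hX := h3 n
    have hY := h4 n
    have e := J31Coeff_eq d ν (i := i) (j := j) (k := k + 1) (l := j + 2 * k + 2) (n := n)
      (s := n + k + 1) (by lia) (by lia) (by lia)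
    have eFst := J31Coeff_eq d ν (i := i + 1) (j := j) (k := k + 1) (l := j + 2 * k + 2)
      (n := n + 1) (s := n + k + 1 + 1) (by lia) (by lia) (by lia)
    have eSndSnd := J31Coeff_eq d ν (i := i) (j := j + 1 + 1) (k := k) (l := j + 2 * k + 2)
      (n := n + 1) (s := n + k + 1) (by lia) (by lia) (by lia)
    simp only [mulTrd, diffFst, diffSnd]
    rw [e, eFst, eSndSnd, poch_succ _ (n + k + 1)]
    simp only [Nat.factorial_succ, poch_succ _ n, poch_succ _ k, pow_succ, pow_add]
    push_cast
    generalize poch (1 + ν) k = p1, poch (1 + ν + d/2) (j + 2 * k + 2) = p2,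
      poch (1 + ν + d) n = p3, poch (1 + 2*ν + d) n = p4,
      poch (1 + 2*ν + d) (n + k + 1) = q at *
    generalize eW : 1 + ν + (k : ℝ) = W, eX : 1 + ν + d + (n : ℝ) = X,
      eY : 1 + 2*ν + d + (n : ℝ) = Y at *
    field_simp
    rw [← eW, ← eX, ← eY, hn']
    ring

lemma J31Coeff_recurrence_snd {d ν : ℝ} (h1 : ∀ n : ℕ, 1 + ν + n ≠ 0)
    (h2 : ∀ n : ℕ, 1 + ν + d/2 + n ≠ 0) (h3 : ∀ n : ℕ, 1 + ν + d + n ≠ 0)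
    (h4 : ∀ n : ℕ, 1 + 2*ν + d + n ≠ 0) (m : ℕ × ℕ × ℕ) :
    mulSnd (diffSnd (diffSnd (J31Coeff d ν))) m + 2 * mulTrd (diffSnd (diffTrd (J31Coeff d ν))) m
      - diffFst (diffFst (J31Coeff d ν)) m + (ν + 1 + d/2) * diffSnd (J31Coeff d ν) m = 0 := by
  rw [diffSnd_diffTrd, mulSnd_diffSnd, mulTrd_diffTrd]
  obtain ⟨i, j, k⟩ := m
  obtain ⟨n, hn⟩ : ∃ n, n = i + 2 * j + 3 * k + 2 := ⟨_, rfl⟩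
  obtain ⟨l, hl⟩ : ∃ l, l = j + 2 * k := ⟨_, rfl⟩
  have hl' : (l : ℝ) = j + 2 * k := by rw [hl]; push_cast; ring
  have hp1 := poch_ne_zero h1 k
  have hp2 := poch_ne_zero h2 l
  have hp3 := poch_ne_zero h3 n
  have hp4 := poch_ne_zero h4 n
  have hZ := h2 l
  have eSnd := J31Coeff_eq d ν (i := i) (j := j + 1) (k := k) (l := l + 1) (n := n) (s := n + k)
    (by lia) (by lia) (by lia)
  have eFstFst := J31Coeff_eq d ν (i := i + 1 + 1) (j := j) (k := k) (l := l) (n := n) (s := n + k)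
    (by lia) (by lia) (by lia)
  simp only [diffFst, diffSnd]
  rw [eSnd, eFstFst]
  simp only [Nat.factorial_succ, poch_succ _ l, pow_succ, pow_add]
  push_cast
  generalize poch (1 + ν) k = p1, poch (1 + ν + d/2) l = p2, poch (1 + ν + d) n = p3,
    poch (1 + 2*ν + d) n = p4, poch (1 + 2*ν + d) (n + k) = q at *
  generalize eZ : 1 + ν + d/2 + (l : ℝ) = Z at *
  field_simp
  rw [← eZ, hl']
  ring

lemma J31Coeff_recurrence_trd {d ν : ℝ} (h1 : ∀ n : ℕ, 1 + ν + n ≠ 0)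
    (h2 : ∀ n : ℕ, 1 + ν + d/2 + n ≠ 0) (h3 : ∀ n : ℕ, 1 + ν + d + n ≠ 0)
    (h4 : ∀ n : ℕ, 1 + 2*ν + d + n ≠ 0) (m : ℕ × ℕ × ℕ) :
    mulTrd (diffTrd (diffTrd (J31Coeff d ν))) m - 2 * diffFst (diffSnd (J31Coeff d ν)) m
      - mulFst (diffSnd (diffSnd (J31Coeff d ν))) m + (ν + 1) * diffTrd (J31Coeff d ν) m = 0 := by
  rw [mulTrd_diffTrd]
  obtain ⟨i, j, k⟩ := m
  obtain ⟨n, hn⟩ : ∃ n, n = i + 2 * j + 3 * k + 3 := ⟨_, rfl⟩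
  obtain ⟨l, hl⟩ : ∃ l, l = j + 2 * k + 1 := ⟨_, rfl⟩
  have hn' : (n : ℝ) = i + 2 * j + 3 * k + 3 := by rw [hn]; push_cast; ring
  have hl' : (l : ℝ) = j + 2 * k + 1 := by rw [hl]; push_cast; ring
  have hp1 := poch_ne_zero h1 k
  have hp2 := poch_ne_zero h2 l
  have hp3 := poch_ne_zero h3 n
  have hp4 := poch_ne_zero h4 n
  have hW := h1 k
  have hZ := h2 l
  have eTrd := J31Coeff_eq d ν (i := i) (j := j) (k := k + 1) (l := l + 1) (n := n)
    (s := n + k + 1) (by lia) (by lia) (by lia)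
  have eFstSnd := J31Coeff_eq d ν (i := i + 1) (j := j + 1) (k := k) (l := l) (n := n)
    (s := n + k) (by lia) (by lia) (by lia)
  have eSndSnd : mulFst (diffSnd (diffSnd (J31Coeff d ν))) (i, j, k) = -(i * (-1) ^ (i + k)
      * poch (1 + 2*ν + d) (n + k) / (i ! * j ! * k ! * poch (1 + ν) k
        * (poch (1 + ν + d/2) l * (1 + ν + d/2 + l)) * poch (1 + ν + d) n
        * poch (1 + 2*ν + d) n)) := by
    obtain _ | i := i
    · simp [mulFst]
    · have e := J31Coeff_eq d ν (i := i) (j := j + 1 + 1) (k := k) (l := l + 1) (n := n)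
        (s := n + k) (by lia) (by lia) (by lia)
      simp only [mulFst, diffSnd]
      rw [e, poch_succ _ l]
      simp only [Nat.factorial_succ, pow_succ, pow_add]
      push_cast
      generalize 1 + ν + d/2 + (l : ℝ) = Z at *
      field_simp
  rw [eSndSnd]
  simp only [diffFst, diffSnd, diffTrd]
  rw [eTrd, eFstSnd]
  simp only [Nat.factorial_succ, poch_succ _ k, poch_succ _ l, poch_succ _ (n + k), pow_succ,
    pow_add]
  push_cast
  generalize poch (1 + ν) k = p1, poch (1 + ν + d/2) l = p2, poch (1 + ν + d) n = p3,
    poch (1 + 2*ν + d) n = p4, poch (1 + 2*ν + d) (n + k) = q at *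
  generalize eW : 1 + ν + (k : ℝ) = W, eZ : 1 + ν + d/2 + (l : ℝ) = Z at *
  field_simp
  rw [← eW, ← eZ, hn', hl']
  ring

lemma add_natCast_ne_zero {a : ℝ} (h : ∀ n : ℤ, n < 0 → a ≠ n) (n : ℕ) : 1 + a + n ≠ 0 := by
  intro h'
  refine h (-(n + 1)) (by lia) ?_
  push_cast
  linarith

theorem J31_solves_muirhead (d ν : ℝ) (hd : 0 < d)
    (h1 : ∀ n : ℤ, n < 0 → ν ≠ n)
    (h2 : ∀ n : ℤ, n < 0 → ν + d/2 ≠ n)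
    (h3 : ∀ n : ℤ, n < 0 → ν + d ≠ n)
    (h4 : ∀ n : ℤ, n < 0 → 2*ν + d ≠ n) :
    ContDiff ℝ (⊤ : ℕ∞) (fun p : ℝ × ℝ × ℝ => J31 d ν p.1 p.2.1 p.2.2) ∧
    ∀ t₁ t₂ t₃ : ℝ,
      (t₁ * deriv (fun s => deriv (fun u => J31 d ν u t₂ t₃) s) t₁
        + 2 * t₂ * deriv (fun s => deriv (fun u => J31 d ν s u t₃) t₂) t₁
        + 2 * t₃ * deriv (fun s => deriv (fun u => J31 d ν s t₂ u) t₃) t₁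
        + t₃ * deriv (fun s => deriv (fun u => J31 d ν t₁ u t₃) s) t₂
        + (ν + 1 + d) * deriv (fun s => J31 d ν s t₂ t₃) t₁
        + J31 d ν t₁ t₂ t₃ = 0) ∧
      (t₂ * deriv (fun s => deriv (fun u => J31 d ν t₁ u t₃) s) t₂
        + 2 * t₃ * deriv (fun s => deriv (fun u => J31 d ν t₁ s u) t₃) t₂
        - deriv (fun s => deriv (fun u => J31 d ν u t₂ t₃) s) t₁
        + (ν + 1 + d/2) * deriv (fun s => J31 d ν t₁ s t₃) t₂ = 0) ∧
      (t₃ * deriv (fun s => deriv (fun u => J31 d ν t₁ t₂ u) s) t₃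
        - 2 * deriv (fun s => deriv (fun u => J31 d ν s u t₃) t₂) t₁
        - t₁ * deriv (fun s => deriv (fun u => J31 d ν t₁ u t₃) s) t₂
        + (ν + 1) * deriv (fun s => J31 d ν t₁ t₂ s) t₃ = 0) := by
  have h1' := add_natCast_ne_zero h1
  have h2' : ∀ n : ℕ, 1 + ν + d/2 + n ≠ 0 := fun n => by
    simpa only [add_assoc] using add_natCast_ne_zero h2 n
  have h3' : ∀ n : ℕ, 1 + ν + d + n ≠ 0 := fun n => by
    simpa only [add_assoc] using add_natCast_ne_zero h3 n
  have h4' : ∀ n : ℕ, 1 + 2*ν + d + n ≠ 0 := fun n => by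
    simpa only [add_assoc] using add_natCast_ne_zero h4 n
  have hc := expBounded_J31Coeff h1' h2' h3' h4'
  simp only [J31_eq_tripleSeries, hc.deriv_fst, hc.deriv_snd, hc.deriv_trd, hc.diffFst.deriv_fst,
    hc.diffSnd.deriv_fst, hc.diffTrd.deriv_fst, hc.diffSnd.deriv_snd, hc.diffTrd.deriv_snd,
    hc.diffTrd.deriv_trd]
  refine ⟨hc.contDiff, fun t₁ t₂ t₃ => ⟨?_, ?_, ?_⟩⟩
  · have key : HasSum (fun _ : ℕ × ℕ × ℕ => (0 : ℝ)) _ :=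
      ((((((hc.diffFst.diffFst.hasSum_mulFst (t₁, t₂, t₃)).add
      ((hc.diffSnd.diffFst.hasSum_mulSnd (t₁, t₂, t₃)).mul_left 2)).add
      ((hc.diffTrd.diffFst.hasSum_mulTrd (t₁, t₂, t₃)).mul_left 2)).add
      (hc.diffSnd.diffSnd.hasSum_mulTrd (t₁, t₂, t₃))).add
      ((hc.diffFst.hasSum (t₁, t₂, t₃)).mul_left (ν + 1 + d))).add
      (hc.hasSum (t₁, t₂, t₃))).congr_fun
      fun m => by
        linear_combination (-(t₁ ^ m.1 * t₂ ^ m.2.1 * t₃ ^ m.2.2)) *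
          J31Coeff_recurrence_fst h1' h2' h3' h4' m
    linear_combination key.unique hasSum_zero
  · have key : HasSum (fun _ : ℕ × ℕ × ℕ => (0 : ℝ)) _ :=
      ((((hc.diffSnd.diffSnd.hasSum_mulSnd (t₁, t₂, t₃)).add
      ((hc.diffTrd.diffSnd.hasSum_mulTrd (t₁, t₂, t₃)).mul_left 2)).sub
      (hc.diffFst.diffFst.hasSum (t₁, t₂, t₃))).add
      ((hc.diffSnd.hasSum (t₁, t₂, t₃)).mul_left (ν + 1 + d/2))).congr_fun
      fun m => by
        linear_combination (-(t₁ ^ m.1 * t₂ ^ m.2.1 * t₃ ^ m.2.2)) *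
          J31Coeff_recurrence_snd h1' h2' h3' h4' m
    linear_combination key.unique hasSum_zero
  · have key : HasSum (fun _ : ℕ × ℕ × ℕ => (0 : ℝ)) _ :=
      ((((hc.diffTrd.diffTrd.hasSum_mulTrd (t₁, t₂, t₃)).sub
      ((hc.diffSnd.diffFst.hasSum (t₁, t₂, t₃)).mul_left 2)).sub
      (hc.diffSnd.diffSnd.hasSum_mulFst (t₁, t₂, t₃))).add
      ((hc.diffTrd.hasSum (t₁, t₂, t₃)).mul_left (ν + 1))).congr_fun
      fun m => by
        linear_combination (-(t₁ ^ m.1 * t₂ ^ m.2.1 * t₃ ^ m.2.2)) *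
          J31Coeff_recurrence_trd h1' h2' h3' h4' m
    linear_combination key.unique hasSum_zero
end
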